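/- Under the standing hypotheses in the context, for every left integral φ and all a, b ∈ A: T₁((id ⊗ id ⊗ φ)(Δ₁₃(a)·Δ₂₃(b))) = E·(p ⊗ 1) where p = (id ⊗ φ)(Δ(a)·(1 ⊗ b)), and T₃((id ⊗ id ⊗ φ)(Δ₂₃(a)·Δ₁₃(b))) = (p' ⊗ 1)·E where p' = (id ⊗ φ)((1 ⊗ a)·Δ(b)); and for every right integral ψ and all a, b ∈ A: T₂((ψ ⊗ id ⊗ id)(Δ₁₂(a)·Δ₁₃(b))) = (1 ⊗ q)·E where q = (ψ ⊗ id)((a ⊗ 1)·Δ(b)), and T₄((ψ ⊗ id ⊗ id)(Δ₁₃(a)·Δ₁₂(b))) = E·(1 ⊗ q') where q' = (ψ ⊗ id)(Δ(a)·(b ⊗ 1)). -/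

import Mathlib

open TensorProduct

/-- Slice map `id ⊗ ω` landing in the left tensor factor. -/
noncomputable def sL {B C : Type} [AddCommGroup B] [Module ℂ B] [AddCommGroup C] [Module ℂ C]
    (ω : C →ₗ[ℂ] ℂ) : (B ⊗[ℂ] C) →ₗ[ℂ] B :=
  (TensorProduct.rid ℂ B).toLinearMap ∘ₗ LinearMap.lTensor B ω

/-- Slice map `ω ⊗ id` landing in the right tensor factor. -/
noncomputable def sR {B C : Type} [AddCommGroup B] [Module ℂ B] [AddCommGroup C] [Module ℂ C]
    (ω : B →ₗ[ℂ] ℂ) : (B ⊗[ℂ] C) →ₗ[ℂ] C :=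
  (TensorProduct.lid ℂ C).toLinearMap ∘ₗ LinearMap.rTensor C ω

/-- `u ⊗ v ↦ u ⊗ (v ⊗ 1)`, placing `A ⊗ A` in legs 1 and 2 of the triple tensor product. -/
noncomputable def leg12 (A : Type) [Ring A] [Algebra ℂ A] :
    (A ⊗[ℂ] A) →ₗ[ℂ] A ⊗[ℂ] (A ⊗[ℂ] A) :=
  TensorProduct.map LinearMap.id ((TensorProduct.mk ℂ A A).flip 1)

/-- `u ⊗ v ↦ u ⊗ (1 ⊗ v)`, placing `A ⊗ A` in legs 1 and 3 of the triple tensor product. -/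
noncomputable def leg13 (A : Type) [Ring A] [Algebra ℂ A] :
    (A ⊗[ℂ] A) →ₗ[ℂ] A ⊗[ℂ] (A ⊗[ℂ] A) :=
  TensorProduct.map LinearMap.id (TensorProduct.mk ℂ A A 1)

/-- A left integral: a nonzero functional with `(id ⊗ φ)(Δ a) ∈ C` for all `a`. -/
noncomputable def IsLeftIntegral (A : Type) [Ring A] [Algebra ℂ A] (Δ : A →ₗ[ℂ] A ⊗[ℂ] A)
    (C : Subalgebra ℂ A) (φ : A →ₗ[ℂ] ℂ) : Prop :=
  φ ≠ 0 ∧ ∀ a : A, sL φ (Δ a) ∈ C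

/-- A right integral: a nonzero functional with `(ψ ⊗ id)(Δ a) ∈ B` for all `a`. -/
noncomputable def IsRightIntegral (A : Type) [Ring A] [Algebra ℂ A] (Δ : A →ₗ[ℂ] A ⊗[ℂ] A)
    (B : Subalgebra ℂ A) (ψ : A →ₗ[ℂ] ℂ) : Prop :=
  ψ ≠ 0 ∧ ∀ a : A, sR ψ (Δ a) ∈ B

/-- There is a faithful set of left integrals. -/
noncomputable def FaithfulLeftIntegrals (A : Type) [Ring A] [Algebra ℂ A]
    (Δ : A →ₗ[ℂ] A ⊗[ℂ] A) (C : Subalgebra ℂ A) : Prop :=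
  (∀ a : A, (∀ φ : A →ₗ[ℂ] ℂ, IsLeftIntegral A Δ C φ → ∀ b : A, φ (a * b) = 0) → a = 0) ∧
  (∀ a : A, (∀ φ : A →ₗ[ℂ] ℂ, IsLeftIntegral A Δ C φ → ∀ b : A, φ (b * a) = 0) → a = 0)

/-- There is a faithful set of right integrals. -/
noncomputable def FaithfulRightIntegrals (A : Type) [Ring A] [Algebra ℂ A]
    (Δ : A →ₗ[ℂ] A ⊗[ℂ] A) (B : Subalgebra ℂ A) : Prop :=
  (∀ a : A, (∀ ψ : A →ₗ[ℂ] ℂ, IsRightIntegral A Δ B ψ → ∀ b : A, ψ (a * b) = 0) → a = 0) ∧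
  (∀ a : A, (∀ ψ : A →ₗ[ℂ] ℂ, IsRightIntegral A Δ B ψ → ∀ b : A, ψ (b * a) = 0) → a = 0)

/-- `T₁ (a ⊗ b) = Δ(a) · (1 ⊗ b)`. -/
noncomputable def Tmap1 (A : Type) [Ring A] [Algebra ℂ A] (Δ : A →ₗ[ℂ] A ⊗[ℂ] A) :
    (A ⊗[ℂ] A) →ₗ[ℂ] A ⊗[ℂ] A :=
  LinearMap.mul' ℂ (A ⊗[ℂ] A) ∘ₗ TensorProduct.map Δ (TensorProduct.mk ℂ A A 1)

/-- `T₂ (c ⊗ a) = (c ⊗ 1) · Δ(a)`. -/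
noncomputable def Tmap2 (A : Type) [Ring A] [Algebra ℂ A] (Δ : A →ₗ[ℂ] A ⊗[ℂ] A) :
    (A ⊗[ℂ] A) →ₗ[ℂ] A ⊗[ℂ] A :=
  LinearMap.mul' ℂ (A ⊗[ℂ] A) ∘ₗ TensorProduct.map ((TensorProduct.mk ℂ A A).flip 1) Δ

/-- `T₃ (a ⊗ b) = (1 ⊗ b) · Δ(a)`. -/
noncomputable def Tmap3 (A : Type) [Ring A] [Algebra ℂ A] (Δ : A →ₗ[ℂ] A ⊗[ℂ] A) :
    (A ⊗[ℂ] A) →ₗ[ℂ] A ⊗[ℂ] A :=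
  (LinearMap.mul' ℂ (A ⊗[ℂ] A) ∘ₗ TensorProduct.map (TensorProduct.mk ℂ A A 1) Δ) ∘ₗ
    (TensorProduct.comm ℂ A A).toLinearMap

/-- `T₄ (c ⊗ a) = Δ(a) · (c ⊗ 1)`. -/
noncomputable def Tmap4 (A : Type) [Ring A] [Algebra ℂ A] (Δ : A →ₗ[ℂ] A ⊗[ℂ] A) :
    (A ⊗[ℂ] A) →ₗ[ℂ] A ⊗[ℂ] A :=
  (LinearMap.mul' ℂ (A ⊗[ℂ] A) ∘ₗ TensorProduct.map Δ ((TensorProduct.mk ℂ A A).flip 1)) ∘ₗ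
    (TensorProduct.comm ℂ A A).toLinearMap

section Slices

variable {V W : Type} [AddCommGroup V] [Module ℂ V] [AddCommGroup W] [Module ℂ W]

@[simp]
theorem sL_tmul (ω : W →ₗ[ℂ] ℂ) (v : V) (w : W) : sL ω (v ⊗ₜ[ℂ] w) = ω w • v := by
  simp [sL]

@[simp]
theorem sR_tmul (ω : V →ₗ[ℂ] ℂ) (v : V) (w : W) : sR ω (v ⊗ₜ[ℂ] w) = ω v • w := by
  simp [sR]

theorem sL_lTensor (ω : W →ₗ[ℂ] ℂ) (F : W →ₗ[ℂ] W) (t : V ⊗[ℂ] W) :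
    sL ω (LinearMap.lTensor V F t) = sL (ω ∘ₗ F) t := by
  induction t with
  | zero => simp
  | tmul v w => simp
  | add x y hx hy => simp [hx, hy]

theorem sR_rTensor (ω : V →ₗ[ℂ] ℂ) (G : V →ₗ[ℂ] V) (t : V ⊗[ℂ] W) :
    sR ω (LinearMap.rTensor W G t) = sR (ω ∘ₗ G) t := by
  induction t with
  | zero => simp
  | tmul v w => simp
  | add x y hx hy => simp [hx, hy]

/-- Left slices of a tensor form a subspace, so a full tensor has every vector as a slice. -/
theorem exists_sL_eq {e : V ⊗[ℂ] W}
    (h : Submodule.span ℂ {x : V | ∃ ω : W →ₗ[ℂ] ℂ, x = sL ω e} = ⊤) (v : V) :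
    ∃ ω : W →ₗ[ℂ] ℂ, sL ω e = v := by
  have hv : v ∈ Submodule.span ℂ {x : V | ∃ ω : W →ₗ[ℂ] ℂ, x = sL ω e} := h ▸ Submodule.mem_top
  induction hv using Submodule.span_induction with
  | mem x hx => exact hx.imp fun _ h => h.symm
  | zero => exact ⟨0, by simp [sL]⟩
  | add x y _ _ hx hy =>
    obtain ⟨ω, rfl⟩ := hx
    obtain ⟨θ, rfl⟩ := hy
    exact ⟨ω + θ, by simp [sL, LinearMap.lTensor_add]⟩
  | smul r x _ hx =>
    obtain ⟨ω, rfl⟩ := hx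
    exact ⟨r • ω, by simp [sL, LinearMap.lTensor_smul]⟩

/-- Right slices of a tensor form a subspace, so a full tensor has every vector as a slice. -/
theorem exists_sR_eq {e : V ⊗[ℂ] W}
    (h : Submodule.span ℂ {x : W | ∃ ω : V →ₗ[ℂ] ℂ, x = sR ω e} = ⊤) (w : W) :
    ∃ ω : V →ₗ[ℂ] ℂ, sR ω e = w := by
  have hw : w ∈ Submodule.span ℂ {x : W | ∃ ω : V →ₗ[ℂ] ℂ, x = sR ω e} := h ▸ Submodule.mem_top
  induction hw using Submodule.span_induction with
  | mem x hx => exact hx.imp fun _ h => h.symm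
  | zero => exact ⟨0, by simp [sR]⟩
  | add x y _ _ hx hy =>
    obtain ⟨ω, rfl⟩ := hx
    obtain ⟨θ, rfl⟩ := hy
    exact ⟨ω + θ, by simp [sR, LinearMap.rTensor_add]⟩
  | smul r x _ hx =>
    obtain ⟨ω, rfl⟩ := hx
    exact ⟨r • ω, by simp [sR, LinearMap.rTensor_smul]⟩

/-- Every vector of `p` is a left slice of the image of a full tensor of `p ⊗ q`. -/
theorem exists_sL_map_subtype_eq {p : Submodule ℂ V} {q : Submodule ℂ W} {e : ↥p ⊗[ℂ] ↥q}
    (h : Submodule.span ℂ {x : ↥p | ∃ ω : ↥q →ₗ[ℂ] ℂ, x = sL ω e} = ⊤) {v : V} (hv : v ∈ p) :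
    ∃ ω : W →ₗ[ℂ] ℂ, sL ω (TensorProduct.map p.subtype q.subtype e) = v := by
  obtain ⟨ω, hω⟩ := exists_sL_eq h ⟨v, hv⟩
  obtain ⟨θ, hθ⟩ := LinearMap.exists_extend ω
  refine ⟨θ, ?_⟩
  have key : ∀ t : ↥p ⊗[ℂ] ↥q,
      sL θ (TensorProduct.map p.subtype q.subtype t) = ((sL ω t : ↥p) : V) := by
    intro t
    induction t with
    | zero => simp
    | tmul x y => simp [← hθ]
    | add x y hx hy => simp [hx, hy]
  rw [key, hω]

/-- Every vector of `q` is a right slice of the image of a full tensor of `p ⊗ q`. -/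
theorem exists_sR_map_subtype_eq {p : Submodule ℂ V} {q : Submodule ℂ W} {e : ↥p ⊗[ℂ] ↥q}
    (h : Submodule.span ℂ {x : ↥q | ∃ ω : ↥p →ₗ[ℂ] ℂ, x = sR ω e} = ⊤) {w : W} (hw : w ∈ q) :
    ∃ ω : V →ₗ[ℂ] ℂ, sR ω (TensorProduct.map p.subtype q.subtype e) = w := by
  obtain ⟨ω, hω⟩ := exists_sR_eq h ⟨w, hw⟩
  obtain ⟨θ, hθ⟩ := LinearMap.exists_extend ω
  refine ⟨θ, ?_⟩
  have key : ∀ t : ↥p ⊗[ℂ] ↥q,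
      sR θ (TensorProduct.map p.subtype q.subtype t) = ((sR ω t : ↥q) : W) := by
    intro t
    induction t with
    | zero => simp
    | tmul x y => simp [← hθ]
    | add x y hx hy => simp [hx, hy]
  rw [key, hω]

end Slices

section Coproduct

variable {A : Type} [Ring A] [Algebra ℂ A]

theorem sL_mul_tmul_one (ω : A →ₗ[ℂ] ℂ) (t : A ⊗[ℂ] A) (q : A) :
    sL ω (t * (q ⊗ₜ[ℂ] (1 : A))) = sL ω t * q := by
  induction t with
  | zero => simp
  | tmul v w => simp
  | add x y hx hy => simp [hx, hy, add_mul]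

theorem sL_tmul_one_mul (ω : A →ₗ[ℂ] ℂ) (t : A ⊗[ℂ] A) (q : A) :
    sL ω ((q ⊗ₜ[ℂ] (1 : A)) * t) = q * sL ω t := by
  induction t with
  | zero => simp
  | tmul v w => simp
  | add x y hx hy => simp [hx, hy, mul_add]

theorem sR_mul_one_tmul (ω : A →ₗ[ℂ] ℂ) (t : A ⊗[ℂ] A) (q : A) :
    sR ω (t * ((1 : A) ⊗ₜ[ℂ] q)) = sR ω t * q := by
  induction t with
  | zero => simp
  | tmul v w => simp
  | add x y hx hy => simp [hx, hy, add_mul]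

theorem sR_one_tmul_mul (ω : A →ₗ[ℂ] ℂ) (t : A ⊗[ℂ] A) (q : A) :
    sR ω (((1 : A) ⊗ₜ[ℂ] q) * t) = q * sR ω t := by
  induction t with
  | zero => simp
  | tmul v w => simp
  | add x y hx hy => simp [hx, hy, mul_add]

theorem sR_leg12_mul (ω : A →ₗ[ℂ] ℂ) (t s : A ⊗[ℂ] A) :
    sR ω (leg12 A t * ((1 : A) ⊗ₜ[ℂ] s)) = (sR ω t ⊗ₜ[ℂ] (1 : A)) * s := by
  induction t with
  | zero => simp
  | tmul v w => simp [leg12, ← TensorProduct.smul_tmul']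
  | add x y hx hy => simp [hx, hy, add_mul, TensorProduct.add_tmul]

theorem sR_mul_leg12 (ω : A →ₗ[ℂ] ℂ) (t s : A ⊗[ℂ] A) :
    sR ω (((1 : A) ⊗ₜ[ℂ] s) * leg12 A t) = s * (sR ω t ⊗ₜ[ℂ] (1 : A)) := by
  induction t with
  | zero => simp
  | tmul v w => simp [leg12, ← TensorProduct.smul_tmul']
  | add x y hx hy => simp [hx, hy, mul_add, TensorProduct.add_tmul]

theorem map_sL_leg12_mul (ω : A →ₗ[ℂ] ℂ) (t s : A ⊗[ℂ] A) :
    TensorProduct.map LinearMap.id (sL ω) (leg12 A t * ((1 : A) ⊗ₜ[ℂ] s)) =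
      t * ((1 : A) ⊗ₜ[ℂ] sL ω s) := by
  induction t with
  | zero => simp
  | tmul v w => simp [leg12, sL_tmul_one_mul]
  | add x y hx hy => simp [hx, hy, add_mul]

theorem map_sL_mul_leg12 (ω : A →ₗ[ℂ] ℂ) (t s : A ⊗[ℂ] A) :
    TensorProduct.map LinearMap.id (sL ω) (((1 : A) ⊗ₜ[ℂ] s) * leg12 A t) =
      ((1 : A) ⊗ₜ[ℂ] sL ω s) * t := by
  induction t with
  | zero => simp
  | tmul v w => simp [leg12, sL_mul_tmul_one]
  | add x y hx hy => simp [hx, hy, mul_add]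

variable (Δ : A →ₗ[ℂ] A ⊗[ℂ] A)

theorem map_sL_assoc_tmul (ω : A →ₗ[ℂ] ℂ) (r : A ⊗[ℂ] A) (v : A) :
    TensorProduct.map LinearMap.id (sL ω) (TensorProduct.assoc ℂ A A A (r ⊗ₜ[ℂ] v)) =
      ω v • r := by
  induction r with
  | zero => simp
  | tmul x y => simp
  | add x y hx hy => simp only [TensorProduct.add_tmul, map_add, smul_add, hx, hy]

theorem map_sL_assoc_rTensor (ω : A →ₗ[ℂ] ℂ) (t : A ⊗[ℂ] A) :
    TensorProduct.map LinearMap.id (sL ω)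
      (TensorProduct.assoc ℂ A A A (LinearMap.rTensor A Δ t)) = Δ (sL ω t) := by
  induction t with
  | zero => simp
  | tmul v w => simp [map_sL_assoc_tmul]
  | add x y hx hy => simp [hx, hy]

theorem map_sL_lTensor (ω : A →ₗ[ℂ] ℂ) (t : A ⊗[ℂ] A) :
    TensorProduct.map LinearMap.id (sL ω) (LinearMap.lTensor A Δ t) =
      LinearMap.lTensor A (sL ω ∘ₗ Δ) t := by
  induction t with
  | zero => simp
  | tmul v w => simp
  | add x y hx hy => simp [hx, hy]

theorem sR_lTensor (ω : A →ₗ[ℂ] ℂ) (t : A ⊗[ℂ] A) :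
    sR ω (LinearMap.lTensor A Δ t) = Δ (sR ω t) := by
  induction t with
  | zero => simp
  | tmul v w => simp
  | add x y hx hy => simp [hx, hy]

theorem sR_assoc_tmul (ω : A →ₗ[ℂ] ℂ) (r : A ⊗[ℂ] A) (v : A) :
    sR ω (TensorProduct.assoc ℂ A A A (r ⊗ₜ[ℂ] v)) = sR ω r ⊗ₜ[ℂ] v := by
  induction r with
  | zero => simp
  | tmul x y => simp [TensorProduct.smul_tmul']
  | add x y hx hy => simp only [TensorProduct.add_tmul, map_add, hx, hy]

theorem sR_assoc_rTensor (ω : A →ₗ[ℂ] ℂ) (t : A ⊗[ℂ] A) :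
    sR ω (TensorProduct.assoc ℂ A A A (LinearMap.rTensor A Δ t)) =
      LinearMap.rTensor A (sR ω ∘ₗ Δ) t := by
  induction t with
  | zero => simp
  | tmul v w => simp [sR_assoc_tmul]
  | add x y hx hy => simp [hx, hy]

theorem tmap1_slice (ω : A →ₗ[ℂ] ℂ) (t s : A ⊗[ℂ] A) :
    Tmap1 A Δ (TensorProduct.map LinearMap.id (sL ω) (leg13 A t * ((1 : A) ⊗ₜ[ℂ] s))) =
      TensorProduct.map LinearMap.id (sL ω)
        (TensorProduct.assoc ℂ A A A (LinearMap.rTensor A Δ t) * ((1 : A) ⊗ₜ[ℂ] s)) := by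
  induction t with
  | zero => simp
  | add x y hx hy => simp only [map_add, add_mul, hx, hy]
  | tmul u v =>
    rw [LinearMap.rTensor_tmul]
    simp only [leg13, Tmap1, TensorProduct.map_tmul, TensorProduct.mk_apply, LinearMap.id_apply,
      Algebra.TensorProduct.tmul_mul_tmul, mul_one, LinearMap.comp_apply, LinearMap.mul'_apply]
    induction Δ u with
    | zero => simp
    | tmul x y =>
      simp only [TensorProduct.assoc_tmul, Algebra.TensorProduct.tmul_mul_tmul, mul_one,
        TensorProduct.map_tmul, LinearMap.id_apply]
      congr 1
      induction s with
      | zero => simp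
      | tmul p q => simp
      | add p q hp hq => simp only [map_add, mul_add, hp, hq]
    | add x y hx hy => simp only [TensorProduct.add_tmul, map_add, add_mul, hx, hy]

theorem tmap3_slice (ω : A →ₗ[ℂ] ℂ) (t s : A ⊗[ℂ] A) :
    Tmap3 A Δ (TensorProduct.map LinearMap.id (sL ω) (((1 : A) ⊗ₜ[ℂ] s) * leg13 A t)) =
      TensorProduct.map LinearMap.id (sL ω)
        (((1 : A) ⊗ₜ[ℂ] s) * TensorProduct.assoc ℂ A A A (LinearMap.rTensor A Δ t)) := by
  induction t with
  | zero => simp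
  | add x y hx hy => simp only [map_add, mul_add, hx, hy]
  | tmul u v =>
    rw [LinearMap.rTensor_tmul]
    simp only [leg13, Tmap3, TensorProduct.map_tmul, TensorProduct.mk_apply, LinearMap.id_apply,
      Algebra.TensorProduct.tmul_mul_tmul, one_mul, LinearMap.comp_apply, LinearMap.mul'_apply,
      LinearEquiv.coe_coe, TensorProduct.comm_tmul]
    induction Δ u with
    | zero => simp
    | tmul x y =>
      simp only [TensorProduct.assoc_tmul, Algebra.TensorProduct.tmul_mul_tmul, one_mul,
        TensorProduct.map_tmul, LinearMap.id_apply]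
      congr 1
      induction s with
      | zero => simp
      | tmul p q => simp
      | add p q hp hq => simp only [map_add, add_mul, hp, hq]
    | add x y hx hy => simp only [TensorProduct.add_tmul, map_add, mul_add, hx, hy]

theorem tmap2_slice (ω : A →ₗ[ℂ] ℂ) (t s : A ⊗[ℂ] A) :
    Tmap2 A Δ (sR ω (leg12 A t * leg13 A s)) =
      sR ω (leg12 A t * LinearMap.lTensor A Δ s) := by
  induction t with
  | zero => simp
  | add x y hx hy => simp only [map_add, add_mul, hx, hy]
  | tmul u v =>
    induction s with
    | zero => simp
    | add x y hx hy => simp only [map_add, mul_add, hx, hy]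
    | tmul x y => simp [leg12, leg13, Tmap2]

theorem tmap4_slice (ω : A →ₗ[ℂ] ℂ) (t s : A ⊗[ℂ] A) :
    Tmap4 A Δ (sR ω (leg13 A s * leg12 A t)) =
      sR ω (LinearMap.lTensor A Δ s * leg12 A t) := by
  induction t with
  | zero => simp
  | add x y hx hy => simp only [map_add, mul_add, hx, hy]
  | tmul u v =>
    induction s with
    | zero => simp
    | add x y hx hy => simp only [map_add, add_mul, hx, hy]
    | tmul x y => simp [leg12, leg13, Tmap4]

section Multiplicative

variable {Δ}

theorem map_sL_lTensor_mul (hΔmul : ∀ a a' : A, Δ (a * a') = Δ a * Δ a') (ω : A →ₗ[ℂ] ℂ) (t : A ⊗[ℂ] A) (b : A) :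
    TensorProduct.map LinearMap.id (sL ω)
        (LinearMap.lTensor A Δ t * ((1 : A) ⊗ₜ[ℂ] Δ b)) =
      LinearMap.lTensor A (sL ω ∘ₗ Δ) (t * ((1 : A) ⊗ₜ[ℂ] b)) := by
  induction t with
  | zero => simp
  | tmul v w => simp [hΔmul]
  | add x y hx hy => simp only [map_add, add_mul, hx, hy]

theorem map_sL_mul_lTensor (hΔmul : ∀ a a' : A, Δ (a * a') = Δ a * Δ a') (ω : A →ₗ[ℂ] ℂ) (t : A ⊗[ℂ] A) (a : A) :
    TensorProduct.map LinearMap.id (sL ω)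
        (((1 : A) ⊗ₜ[ℂ] Δ a) * LinearMap.lTensor A Δ t) =
      LinearMap.lTensor A (sL ω ∘ₗ Δ) (((1 : A) ⊗ₜ[ℂ] a) * t) := by
  induction t with
  | zero => simp
  | tmul v w => simp [hΔmul]
  | add x y hx hy => simp only [map_add, mul_add, hx, hy]

theorem leg12_mul_assoc_tmul (r s : A ⊗[ℂ] A) (v : A) :
    leg12 A r * TensorProduct.assoc ℂ A A A (s ⊗ₜ[ℂ] v) =
      TensorProduct.assoc ℂ A A A ((r * s) ⊗ₜ[ℂ] v) := by
  induction r with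
  | zero => simp
  | add x y hx hy => simp only [map_add, add_mul, TensorProduct.add_tmul, hx, hy]
  | tmul p q =>
    induction s with
    | zero => simp
    | add x y hx hy => simp only [map_add, mul_add, TensorProduct.add_tmul, hx, hy]
    | tmul x y => simp [leg12]

theorem assoc_tmul_mul_leg12 (r s : A ⊗[ℂ] A) (v : A) :
    TensorProduct.assoc ℂ A A A (s ⊗ₜ[ℂ] v) * leg12 A r =
      TensorProduct.assoc ℂ A A A ((s * r) ⊗ₜ[ℂ] v) := by
  induction r with
  | zero => simp
  | add x y hx hy => simp only [map_add, mul_add, TensorProduct.add_tmul, hx, hy]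
  | tmul p q =>
    induction s with
    | zero => simp
    | add x y hx hy => simp only [map_add, add_mul, TensorProduct.add_tmul, hx, hy]
    | tmul x y => simp [leg12]

theorem sR_leg12_mul_assoc_rTensor (hΔmul : ∀ a a' : A, Δ (a * a') = Δ a * Δ a') (ω : A →ₗ[ℂ] ℂ) (t : A ⊗[ℂ] A) (a : A) :
    sR ω (leg12 A (Δ a) * TensorProduct.assoc ℂ A A A (LinearMap.rTensor A Δ t)) =
      LinearMap.rTensor A (sR ω ∘ₗ Δ) ((a ⊗ₜ[ℂ] (1 : A)) * t) := by
  induction t with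
  | zero => simp
  | tmul v w => simp [leg12_mul_assoc_tmul, sR_assoc_tmul, hΔmul]
  | add x y hx hy => simp only [map_add, mul_add, hx, hy]

theorem sR_assoc_rTensor_mul_leg12 (hΔmul : ∀ a a' : A, Δ (a * a') = Δ a * Δ a') (ω : A →ₗ[ℂ] ℂ) (t : A ⊗[ℂ] A) (b : A) :
    sR ω (TensorProduct.assoc ℂ A A A (LinearMap.rTensor A Δ t) * leg12 A (Δ b)) =
      LinearMap.rTensor A (sR ω ∘ₗ Δ) (t * (b ⊗ₜ[ℂ] (1 : A))) := by
  induction t with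
  | zero => simp
  | tmul v w => simp [assoc_tmul_mul_leg12, sR_assoc_tmul, hΔmul]
  | add x y hx hy => simp only [map_add, add_mul, hx, hy]

end Multiplicative

end Coproduct

section Separability

variable {A : Type} [Ring A] [Algebra ℂ A] {B C : Subalgebra ℂ A} {F : A →ₗ[ℂ] A}
  {φ ω : A →ₗ[ℂ] ℂ}

theorem lTensor_map_val_mul (hF : ∀ c ∈ C, ∀ x, F (c * x) = c * F x) (e : ↥B ⊗[ℂ] ↥C)
    (w : A ⊗[ℂ] A) :
    LinearMap.lTensor A F (TensorProduct.map B.val.toLinearMap C.val.toLinearMap e * w) =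
      TensorProduct.map B.val.toLinearMap C.val.toLinearMap e * LinearMap.lTensor A F w := by
  induction e with
  | zero => simp
  | add x y hx hy => simp only [map_add, add_mul, hx, hy]
  | tmul b c =>
    induction w with
    | zero => simp
    | add x y hx hy => simp only [map_add, mul_add, hx, hy]
    | tmul x y => simp [hF]

theorem lTensor_mul_map_val (hF : ∀ c ∈ C, ∀ x, F (x * c) = F x * c) (e : ↥B ⊗[ℂ] ↥C)
    (w : A ⊗[ℂ] A) :
    LinearMap.lTensor A F (w * TensorProduct.map B.val.toLinearMap C.val.toLinearMap e) =
      LinearMap.lTensor A F w * TensorProduct.map B.val.toLinearMap C.val.toLinearMap e := by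
  induction e with
  | zero => simp
  | add x y hx hy => simp only [map_add, mul_add, hx, hy]
  | tmul b c =>
    induction w with
    | zero => simp
    | add x y hx hy => simp only [map_add, add_mul, hx, hy]
    | tmul x y => simp [hF]

theorem rTensor_map_val_mul (hF : ∀ b ∈ B, ∀ x, F (b * x) = b * F x) (e : ↥B ⊗[ℂ] ↥C)
    (w : A ⊗[ℂ] A) :
    LinearMap.rTensor A F (TensorProduct.map B.val.toLinearMap C.val.toLinearMap e * w) =
      TensorProduct.map B.val.toLinearMap C.val.toLinearMap e * LinearMap.rTensor A F w := by
  induction e with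
  | zero => simp
  | add x y hx hy => simp only [map_add, add_mul, hx, hy]
  | tmul b c =>
    induction w with
    | zero => simp
    | add x y hx hy => simp only [map_add, mul_add, hx, hy]
    | tmul x y => simp [hF]

theorem rTensor_mul_map_val (hF : ∀ b ∈ B, ∀ x, F (x * b) = F x * b) (e : ↥B ⊗[ℂ] ↥C)
    (w : A ⊗[ℂ] A) :
    LinearMap.rTensor A F (w * TensorProduct.map B.val.toLinearMap C.val.toLinearMap e) =
      LinearMap.rTensor A F w * TensorProduct.map B.val.toLinearMap C.val.toLinearMap e := by
  induction e with
  | zero => simp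
  | add x y hx hy => simp only [map_add, mul_add, hx, hy]
  | tmul b c =>
    induction w with
    | zero => simp
    | add x y hx hy => simp only [map_add, add_mul, hx, hy]
    | tmul x y => simp [hF]

variable {E : A ⊗[ℂ] A}

/-- A tensor of the form `E * (id ⊗ F) w`, with `F` valued in `C`, is `E * (p ⊗ 1)` for the
slice `p` of `w` by `ω ∘ F`. -/
theorem mul_lTensor_eq (hFC : ∀ x, F x ∈ C)
    (hS : ∀ c ∈ C, ∃ b : A, E * ((1 : A) ⊗ₜ[ℂ] c) = E * (b ⊗ₜ[ℂ] (1 : A)))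
    (hω : sL ω E = 1) (hφ : ω ∘ₗ F = φ) {w : A ⊗[ℂ] A}
    (hw : E * LinearMap.lTensor A F w = LinearMap.lTensor A F w) :
    LinearMap.lTensor A F w = E * (sL φ w ⊗ₜ[ℂ] (1 : A)) := by
  obtain ⟨q, hq⟩ : ∃ q : A, E * LinearMap.lTensor A F w = E * (q ⊗ₜ[ℂ] (1 : A)) := by
    clear hw
    induction w with
    | zero => exact ⟨0, by simp⟩
    | add x y hx hy =>
      obtain ⟨p, hp⟩ := hx
      obtain ⟨q, hq⟩ := hy
      exact ⟨p + q, by rw [map_add, mul_add, hp, hq, TensorProduct.add_tmul, mul_add]⟩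
    | tmul x y =>
      obtain ⟨b, hb⟩ := hS _ (hFC y)
      refine ⟨b * x, ?_⟩
      have h1 : x ⊗ₜ[ℂ] F y = ((1 : A) ⊗ₜ[ℂ] F y) * (x ⊗ₜ[ℂ] (1 : A)) := by simp
      have h2 : (b * x) ⊗ₜ[ℂ] (1 : A) = (b ⊗ₜ[ℂ] (1 : A)) * (x ⊗ₜ[ℂ] (1 : A)) := by simp
      rw [LinearMap.lTensor_tmul, h1, h2, ← mul_assoc, hb, mul_assoc]
  rw [hw] at hq
  have hqφ : sL φ w = q := by
    rw [← hφ, ← sL_lTensor, hq, sL_mul_tmul_one, hω, one_mul]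
  rw [hqφ, hq]

/-- A tensor of the form `(id ⊗ F) w * E`, with `F` valued in `C`, is `(p ⊗ 1) * E` for the
slice `p` of `w` by `ω ∘ F`. -/
theorem lTensor_mul_eq (hFC : ∀ x, F x ∈ C)
    (hS : ∀ c ∈ C, ∃ b : A, ((1 : A) ⊗ₜ[ℂ] c) * E = (b ⊗ₜ[ℂ] (1 : A)) * E)
    (hω : sL ω E = 1) (hφ : ω ∘ₗ F = φ) {w : A ⊗[ℂ] A}
    (hw : LinearMap.lTensor A F w * E = LinearMap.lTensor A F w) :
    LinearMap.lTensor A F w = (sL φ w ⊗ₜ[ℂ] (1 : A)) * E := by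
  obtain ⟨q, hq⟩ : ∃ q : A, LinearMap.lTensor A F w * E = (q ⊗ₜ[ℂ] (1 : A)) * E := by
    clear hw
    induction w with
    | zero => exact ⟨0, by simp⟩
    | add x y hx hy =>
      obtain ⟨p, hp⟩ := hx
      obtain ⟨q, hq⟩ := hy
      exact ⟨p + q, by rw [map_add, add_mul, hp, hq, TensorProduct.add_tmul, add_mul]⟩
    | tmul x y =>
      obtain ⟨b, hb⟩ := hS _ (hFC y)
      refine ⟨x * b, ?_⟩
      have h1 : x ⊗ₜ[ℂ] F y = (x ⊗ₜ[ℂ] (1 : A)) * ((1 : A) ⊗ₜ[ℂ] F y) := by simp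
      have h2 : (x * b) ⊗ₜ[ℂ] (1 : A) = (x ⊗ₜ[ℂ] (1 : A)) * (b ⊗ₜ[ℂ] (1 : A)) := by simp
      rw [LinearMap.lTensor_tmul, h1, h2, mul_assoc, hb, mul_assoc]
  rw [hw] at hq
  have hqφ : sL φ w = q := by
    rw [← hφ, ← sL_lTensor, hq, sL_tmul_one_mul, hω, mul_one]
  rw [hqφ, hq]

/-- A tensor of the form `E * (F ⊗ id) w`, with `F` valued in `B`, is `E * (1 ⊗ p)` for the
slice `p` of `w` by `ω ∘ F`. -/
theorem mul_rTensor_eq (hFB : ∀ x, F x ∈ B)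
    (hS : ∀ b ∈ B, ∃ c : A, E * (b ⊗ₜ[ℂ] (1 : A)) = E * ((1 : A) ⊗ₜ[ℂ] c))
    (hω : sR ω E = 1) (hφ : ω ∘ₗ F = φ) {w : A ⊗[ℂ] A}
    (hw : E * LinearMap.rTensor A F w = LinearMap.rTensor A F w) :
    LinearMap.rTensor A F w = E * ((1 : A) ⊗ₜ[ℂ] sR φ w) := by
  obtain ⟨q, hq⟩ : ∃ q : A, E * LinearMap.rTensor A F w = E * ((1 : A) ⊗ₜ[ℂ] q) := by
    clear hw
    induction w with
    | zero => exact ⟨0, by simp⟩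
    | add x y hx hy =>
      obtain ⟨p, hp⟩ := hx
      obtain ⟨q, hq⟩ := hy
      exact ⟨p + q, by rw [map_add, mul_add, hp, hq, TensorProduct.tmul_add, mul_add]⟩
    | tmul x y =>
      obtain ⟨c, hc⟩ := hS _ (hFB x)
      refine ⟨c * y, ?_⟩
      have h1 : F x ⊗ₜ[ℂ] y = (F x ⊗ₜ[ℂ] (1 : A)) * ((1 : A) ⊗ₜ[ℂ] y) := by simp
      have h2 : (1 : A) ⊗ₜ[ℂ] (c * y) = ((1 : A) ⊗ₜ[ℂ] c) * ((1 : A) ⊗ₜ[ℂ] y) := by simp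
      rw [LinearMap.rTensor_tmul, h1, h2, ← mul_assoc, hc, mul_assoc]
  rw [hw] at hq
  have hqφ : sR φ w = q := by
    rw [← hφ, ← sR_rTensor, hq, sR_mul_one_tmul, hω, one_mul]
  rw [hqφ, hq]

/-- A tensor of the form `(F ⊗ id) w * E`, with `F` valued in `B`, is `(1 ⊗ p) * E` for the
slice `p` of `w` by `ω ∘ F`. -/
theorem rTensor_mul_eq (hFB : ∀ x, F x ∈ B)
    (hS : ∀ b ∈ B, ∃ c : A, (b ⊗ₜ[ℂ] (1 : A)) * E = ((1 : A) ⊗ₜ[ℂ] c) * E)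
    (hω : sR ω E = 1) (hφ : ω ∘ₗ F = φ) {w : A ⊗[ℂ] A}
    (hw : LinearMap.rTensor A F w * E = LinearMap.rTensor A F w) :
    LinearMap.rTensor A F w = ((1 : A) ⊗ₜ[ℂ] sR φ w) * E := by
  obtain ⟨q, hq⟩ : ∃ q : A, LinearMap.rTensor A F w * E = ((1 : A) ⊗ₜ[ℂ] q) * E := by
    clear hw
    induction w with
    | zero => exact ⟨0, by simp⟩
    | add x y hx hy =>
      obtain ⟨p, hp⟩ := hx
      obtain ⟨q, hq⟩ := hy
      exact ⟨p + q, by rw [map_add, add_mul, hp, hq, TensorProduct.tmul_add, add_mul]⟩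
    | tmul x y =>
      obtain ⟨c, hc⟩ := hS _ (hFB x)
      refine ⟨y * c, ?_⟩
      have h1 : F x ⊗ₜ[ℂ] y = ((1 : A) ⊗ₜ[ℂ] y) * (F x ⊗ₜ[ℂ] (1 : A)) := by simp
      have h2 : (1 : A) ⊗ₜ[ℂ] (y * c) = ((1 : A) ⊗ₜ[ℂ] y) * ((1 : A) ⊗ₜ[ℂ] c) := by simp
      rw [LinearMap.rTensor_tmul, h1, h2, mul_assoc, hc, mul_assoc]
  rw [hw] at hq
  have hqφ : sR φ w = q := by
    rw [← hφ, ← sR_rTensor, hq, sR_one_tmul_mul, hω, mul_one]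
  rw [hqφ, hq]

end Separability

section Fullness

variable {A : Type} [Ring A] [Algebra ℂ A] {Δ : A →ₗ[ℂ] A ⊗[ℂ] A}

theorem functional_eq_of_sL_eq
    (hfull : Submodule.span ℂ {x : A | ∃ ω : A →ₗ[ℂ] ℂ, ∃ a : A, x = sR ω (Δ a)} = ⊤)
    {φ ψ : A →ₗ[ℂ] ℂ} (h : ∀ a, sL φ (Δ a) = sL ψ (Δ a)) : φ = ψ := by
  refine LinearMap.ext_on hfull ?_
  rintro _ ⟨ω, a, rfl⟩
  have key : ∀ (θ : A →ₗ[ℂ] ℂ) (t : A ⊗[ℂ] A), θ (sR ω t) = ω (sL θ t) := by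
    intro θ t
    induction t with
    | zero => simp
    | tmul v w => simp [mul_comm]
    | add x y hx hy => simp [hx, hy]
  rw [key, key, h]

theorem functional_eq_of_sR_eq
    (hfull : Submodule.span ℂ {x : A | ∃ ω : A →ₗ[ℂ] ℂ, ∃ a : A, x = sL ω (Δ a)} = ⊤)
    {φ ψ : A →ₗ[ℂ] ℂ} (h : ∀ a, sR φ (Δ a) = sR ψ (Δ a)) : φ = ψ := by
  refine LinearMap.ext_on hfull ?_
  rintro _ ⟨ω, a, rfl⟩
  have key : ∀ (θ : A →ₗ[ℂ] ℂ) (t : A ⊗[ℂ] A), θ (sL ω t) = ω (sR θ t) := by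
    intro θ t
    induction t with
    | zero => simp
    | tmul v w => simp [mul_comm]
    | add x y hx hy => simp [hx, hy]
  rw [key, key, h]

end Fullness

theorem statement11
    (A : Type) [Ring A] [Algebra ℂ A]
    (Δ : A →ₗ[ℂ] A ⊗[ℂ] A)
    (hΔmul : ∀ a a' : A, Δ (a * a') = Δ a * Δ a')
    (hΔcoassoc : ∀ a : A,
      TensorProduct.assoc ℂ A A A (LinearMap.rTensor A Δ (Δ a)) = LinearMap.lTensor A Δ (Δ a))
    (hΔfullL : Submodule.span ℂ {x : A | ∃ ω : A →ₗ[ℂ] ℂ, ∃ a : A, x = sL ω (Δ a)} = ⊤)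
    (hΔfullR : Submodule.span ℂ {x : A | ∃ ω : A →ₗ[ℂ] ℂ, ∃ a : A, x = sR ω (Δ a)} = ⊤)
    (E : A ⊗[ℂ] A)
    (hEE : E * E = E)
    (hEΔ : ∀ a : A, E * Δ a = Δ a ∧ Δ a * E = Δ a)
    (hranL : (Submodule.span ℂ {y : A ⊗[ℂ] A | ∃ a z, y = Δ a * z} : Set (A ⊗[ℂ] A)) =
      {y : A ⊗[ℂ] A | ∃ z, y = E * z})
    (hranR : (Submodule.span ℂ {y : A ⊗[ℂ] A | ∃ a z, y = z * Δ a} : Set (A ⊗[ℂ] A)) =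
      {y : A ⊗[ℂ] A | ∃ z, y = z * E})
    (hΔE1 : TensorProduct.assoc ℂ A A A (LinearMap.rTensor A Δ E) =
      leg12 A E * ((1 : A) ⊗ₜ[ℂ] E))
    (hΔE2 : leg12 A E * ((1 : A) ⊗ₜ[ℂ] E) = ((1 : A) ⊗ₜ[ℂ] E) * leg12 A E)
    (B C : Subalgebra ℂ A)
    (E' : ↥B ⊗[ℂ] ↥C)
    (hE'E : TensorProduct.map B.val.toLinearMap C.val.toLinearMap E' = E)
    (hE'full1 : Submodule.span ℂ {x : ↥B | ∃ ω : ↥C →ₗ[ℂ] ℂ, x = sL ω E'} = ⊤)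
    (hE'full2 : Submodule.span ℂ {y : ↥C | ∃ ω : ↥B →ₗ[ℂ] ℂ, y = sR ω E'} = ⊤)
    (SB : ↥B ≃ₗ[ℂ] ↥C) (SC : ↥C ≃ₗ[ℂ] ↥B)
    (hSBanti : ∀ b b' : ↥B, SB (b * b') = SB b' * SB b)
    (hSCanti : ∀ c c' : ↥C, SC (c * c') = SC c' * SC c)
    (hSBrel : ∀ b : ↥B, E' * (b ⊗ₜ[ℂ] (1 : ↥C)) = E' * ((1 : ↥B) ⊗ₜ[ℂ] SB b))
    (hSCrel : ∀ c : ↥C, ((1 : ↥B) ⊗ₜ[ℂ] c) * E' = (SC c ⊗ₜ[ℂ] (1 : ↥C)) * E')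
 :
    (∀ φ : A →ₗ[ℂ] ℂ, IsLeftIntegral A Δ C φ → ∀ a b : A,
      Tmap1 A Δ (TensorProduct.map LinearMap.id (sL φ)
          (leg13 A (Δ a) * ((1 : A) ⊗ₜ[ℂ] Δ b))) =
        E * (sL φ (Δ a * ((1 : A) ⊗ₜ[ℂ] b)) ⊗ₜ[ℂ] (1 : A)) ∧
      Tmap3 A Δ (TensorProduct.map LinearMap.id (sL φ)
          (((1 : A) ⊗ₜ[ℂ] Δ a) * leg13 A (Δ b))) =
        (sL φ (((1 : A) ⊗ₜ[ℂ] a) * Δ b) ⊗ₜ[ℂ] (1 : A)) * E) ∧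
    (∀ ψ : A →ₗ[ℂ] ℂ, IsRightIntegral A Δ B ψ → ∀ a b : A,
      Tmap2 A Δ (sR ψ (leg12 A (Δ a) * leg13 A (Δ b))) =
        ((1 : A) ⊗ₜ[ℂ] sR ψ ((a ⊗ₜ[ℂ] (1 : A)) * Δ b)) * E ∧
      Tmap4 A Δ (sR ψ (leg13 A (Δ a) * leg12 A (Δ b))) =
        E * ((1 : A) ⊗ₜ[ℂ] sR ψ (Δ a * (b ⊗ₜ[ℂ] (1 : A))))) := by
  have hE1 : Δ 1 = E := by
    have hmem : E ∈ (Submodule.span ℂ {y : A ⊗[ℂ] A | ∃ a z, y = Δ a * z} : Set (A ⊗[ℂ] A)) := by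
      rw [hranL]
      exact ⟨1, (mul_one E).symm⟩
    have hfix : ∀ y ∈ Submodule.span ℂ {y : A ⊗[ℂ] A | ∃ a z, y = Δ a * z}, Δ 1 * y = y := by
      intro y hy
      induction hy using Submodule.span_induction with
      | mem x hx =>
        obtain ⟨a, z, rfl⟩ := hx
        rw [← mul_assoc, ← hΔmul, one_mul]
      | zero => simp
      | add x y _ _ hx hy => rw [mul_add, hx, hy]
      | smul r x _ hx => rw [mul_smul_comm, hx]
    rw [← (hEΔ 1).2, hfix E hmem]
  have hΔE3 : LinearMap.lTensor A Δ E = leg12 A E * ((1 : A) ⊗ₜ[ℂ] E) := by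
    rw [← hΔE1, ← hE1, hΔcoassoc]
  have hmap (e : ↥B ⊗[ℂ] ↥C) : TensorProduct.map B.toSubmodule.subtype C.toSubmodule.subtype e =
      TensorProduct.map B.val.toLinearMap C.val.toLinearMap e := rfl
  have hΔC : ∀ c ∈ C, Δ c = (c ⊗ₜ[ℂ] (1 : A)) * E ∧ Δ c = E * (c ⊗ₜ[ℂ] (1 : A)) := by
    intro c hc
    obtain ⟨ω, hω⟩ := exists_sR_map_subtype_eq (p := B.toSubmodule) (q := C.toSubmodule)
      hE'full2 hc
    rw [hmap, hE'E] at hω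
    rw [← hω, ← sR_lTensor, ← sR_leg12_mul, ← sR_mul_leg12, ← hΔE2, hΔE3]
    exact ⟨rfl, rfl⟩
  have hΔB : ∀ b ∈ B, Δ b = ((1 : A) ⊗ₜ[ℂ] b) * E ∧ Δ b = E * ((1 : A) ⊗ₜ[ℂ] b) := by
    intro b hb
    obtain ⟨ω, hω⟩ := exists_sL_map_subtype_eq (p := B.toSubmodule) (q := C.toSubmodule)
      hE'full1 hb
    rw [hmap, hE'E] at hω
    rw [← hω, ← map_sL_assoc_rTensor, ← map_sL_leg12_mul, ← map_sL_mul_leg12, ← hΔE2, hΔE1]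
    exact ⟨rfl, rfl⟩
  have hB : ∀ b : ↥B, E * ((b : A) ⊗ₜ[ℂ] (1 : A)) = E * ((1 : A) ⊗ₜ[ℂ] (SB b : A)) := by
    intro b
    have h := congrArg (Algebra.TensorProduct.map B.val C.val) (hSBrel b)
    rw [map_mul, map_mul, Algebra.TensorProduct.map_tmul, Algebra.TensorProduct.map_tmul] at h
    rw [← hE'E]
    exact h
  have hC : ∀ c : ↥C, ((1 : A) ⊗ₜ[ℂ] (c : A)) * E = ((SC c : A) ⊗ₜ[ℂ] (1 : A)) * E := by
    intro c
    have h := congrArg (Algebra.TensorProduct.map B.val C.val) (hSCrel c)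
    rw [map_mul, map_mul, Algebra.TensorProduct.map_tmul, Algebra.TensorProduct.map_tmul] at h
    rw [← hE'E]
    exact h
  constructor
  · rintro φ ⟨-, hφ⟩ a b
    obtain ⟨ω, hω⟩ := exists_sL_map_subtype_eq (p := B.toSubmodule) (q := C.toSubmodule)
      hE'full1 B.one_mem
    rw [hmap, hE'E] at hω
    have hωφ : ω ∘ₗ (sL φ ∘ₗ Δ) = φ := by
      refine functional_eq_of_sL_eq hΔfullR fun x => ?_
      rw [← sL_lTensor, ← map_sL_lTensor, ← hΔcoassoc, map_sL_assoc_rTensor, (hΔC _ (hφ x)).2,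
        sL_mul_tmul_one, hω, one_mul]
    constructor
    · rw [tmap1_slice, hΔcoassoc, map_sL_lTensor_mul hΔmul]
      refine mul_lTensor_eq (A := A) hφ (fun c hc => ⟨SB.symm ⟨c, hc⟩, ?_⟩) hω hωφ ?_
      · rw [hB, LinearEquiv.apply_symm_apply]
      · rw [← hE'E, ← lTensor_map_val_mul, hE'E, ← mul_assoc, (hEΔ a).1]
        intro c hc x
        simp only [LinearMap.comp_apply]
        rw [hΔmul, (hΔC c hc).1, mul_assoc, (hEΔ x).1, sL_tmul_one_mul]
    · rw [tmap3_slice, hΔcoassoc, map_sL_mul_lTensor hΔmul]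
      refine lTensor_mul_eq (A := A) hφ (fun c hc => ⟨SC ⟨c, hc⟩, hC ⟨c, hc⟩⟩) hω hωφ ?_
      rw [← hE'E, ← lTensor_mul_map_val, hE'E, mul_assoc, (hEΔ b).2]
      intro c hc x
      simp only [LinearMap.comp_apply]
      rw [hΔmul, (hΔC c hc).2, ← mul_assoc, (hEΔ x).2, sL_mul_tmul_one]
  · rintro ψ ⟨-, hψ⟩ a b
    obtain ⟨ω, hω⟩ := exists_sR_map_subtype_eq (p := B.toSubmodule) (q := C.toSubmodule)
      hE'full2 C.one_mem
    rw [hmap, hE'E] at hω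
    have hωψ : ω ∘ₗ (sR ψ ∘ₗ Δ) = ψ := by
      refine functional_eq_of_sR_eq hΔfullL fun x => ?_
      rw [← sR_rTensor, ← sR_assoc_rTensor, hΔcoassoc, sR_lTensor, (hΔB _ (hψ x)).2,
        sR_mul_one_tmul, hω, one_mul]
    constructor
    · rw [tmap2_slice, ← hΔcoassoc, sR_leg12_mul_assoc_rTensor hΔmul]
      refine rTensor_mul_eq (A := A) hψ (fun b hb => ⟨SC.symm ⟨b, hb⟩, ?_⟩) hω hωψ ?_
      · rw [hC, LinearEquiv.apply_symm_apply]
      · rw [← hE'E, ← rTensor_mul_map_val, hE'E, mul_assoc, (hEΔ b).2]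
        intro c hc x
        simp only [LinearMap.comp_apply]
        rw [hΔmul, (hΔB c hc).2, ← mul_assoc, (hEΔ x).2, sR_mul_one_tmul]
    · rw [tmap4_slice, ← hΔcoassoc, sR_assoc_rTensor_mul_leg12 hΔmul]
      refine mul_rTensor_eq (A := A) hψ (fun b hb => ⟨SB ⟨b, hb⟩, hB ⟨b, hb⟩⟩) hω hωψ ?_
      rw [← hE'E, ← rTensor_map_val_mul, hE'E, ← mul_assoc, (hEΔ a).1]
      intro c hc x
      simp only [LinearMap.comp_apply]
      rw [hΔmul, (hΔB c hc).1, mul_assoc, (hEΔ x).1, sR_one_tmul_mul]
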